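/- Let R = S ×_k T be a non-trivial fiber product and let M be a finitely generated R-module. (a) If Ext_R^i(M, M ⊕ R) = 0 for all sufficiently large i, then M has projective dimension at most 1 over R. (b) If Ext_R^i(M, M ⊕ R) = 0 for all i ≥ 1, then M is free over R. In particular, R satisfies the Auslander–Reiten Conjecture. -/

import Mathlib

open CategoryTheory Opposite IsLocalRing

noncomputable section

set_option maxHeartbeats 1000000
set_option synthInstance.maxHeartbeats 1000000

/-- Vanishing of `Tor_i^A(M, N)`. -/
abbrev TorZero (A : Type) [CommRing A] (M N : Type) [AddCommGroup M] [Module A M]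
    [AddCommGroup N] [Module A N] (i : ℕ) : Prop :=
  Subsingleton (((Tor (ModuleCat A) i).obj (ModuleCat.of A M)).obj (ModuleCat.of A N))

/-- Vanishing of `Ext^i_A(M, N)`. -/
abbrev ExtZero (A : Type) [CommRing A] (M N : Type) [AddCommGroup M] [Module A M]
    [AddCommGroup N] [Module A N] (i : ℕ) : Prop :=
  Subsingleton (((Ext A (ModuleCat A) i).obj (op (ModuleCat.of A M))).obj (ModuleCat.of A N))

/-- `M` has projective dimension at most `n` over `A`:
`Ext^i_A(M, -) = 0` for all `i > n`. -/
def PdLE (A : Type) [CommRing A] (M : Type) [AddCommGroup M] [Module A M] (n : ℕ) : Prop :=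
  ∀ (N : ModuleCat A) (i : ℕ), n < i →
    Subsingleton (((Ext A (ModuleCat A) i).obj (op (ModuleCat.of A M))).obj N)

/-- `N` has injective dimension at most `n` over `A`:
`Ext^i_A(-, N) = 0` for all `i > n`. -/
def IdLE (A : Type) [CommRing A] (N : Type) [AddCommGroup N] [Module A N] (n : ℕ) : Prop :=
  ∀ (X : ModuleCat A) (i : ℕ), n < i →
    Subsingleton (((Ext A (ModuleCat A) i).obj (op X)).obj (ModuleCat.of A N))

/-- The depth of a module over a noetherian local ring, as an extended natural number:
`inf { i | Ext^i_A(k, M) ≠ 0 }`. -/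
def depthM (A : Type) [CommRing A] [IsLocalRing A] (M : Type) [AddCommGroup M]
    [Module A M] : ℕ∞ :=
  sInf {n : ℕ∞ | ∃ i : ℕ, n = i ∧
    ¬ Subsingleton (((Ext A (ModuleCat A) i).obj
        (op (ModuleCat.of A (A ⧸ maximalIdeal A)))).obj (ModuleCat.of A M))}

/-- The fiber product `S ×ₖ T` as a subring of `S × T`. -/
def fiberProd {S T k : Type} [CommRing S] [CommRing T] [CommRing k]
    (πS : S →+* k) (πT : T →+* k) : Subring (S × T) :=
  RingHom.eqLocus (πS.comp (RingHom.fst S T)) (πT.comp (RingHom.snd S T))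

/-- The projection from the fiber product to `S`. -/
def ρS {S T k : Type} [CommRing S] [CommRing T] [CommRing k]
    (πS : S →+* k) (πT : T →+* k) : ↥(fiberProd πS πT) →+* S :=
  (RingHom.fst S T).comp (fiberProd πS πT).subtype

/-- The projection from the fiber product to `T`. -/
def ρT {S T k : Type} [CommRing S] [CommRing T] [CommRing k]
    (πS : S →+* k) (πT : T →+* k) : ↥(fiberProd πS πT) →+* T :=
  (RingHom.snd S T).comp (fiberProd πS πT).subtype

/-- The `i`-th Betti number of a module `M` over a noetherian local ring `A`:
the `k`-dimension of `Tor_i^A(M, k) ⊗_A k`; since `Tor_i^A(M, k)` is annihilated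
by the maximal ideal, this is `dim_k Tor_i^A(M, k)`. -/
noncomputable def betti (A : Type) [CommRing A] [IsLocalRing A] (M : Type) [AddCommGroup M]
    [Module A M] (i : ℕ) : ℕ :=
  let X : ModuleCat A :=
    ((Tor (ModuleCat A) i).obj (ModuleCat.of A M)).obj (ModuleCat.of A (A ⧸ maximalIdeal A))
  Module.finrank (A ⧸ maximalIdeal A) (X ⧸ (maximalIdeal A • (⊤ : Submodule A X)))

/-- `M` is a first syzygy over `A` of a finitely generated `A`-module, i.e. `M` embeds
into a finite free `A`-module (as the kernel of `F ↠ L` for the quotient `L`). -/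
def IsFirstSyzygy (A : Type) [CommRing A] (M : Type) [AddCommGroup M] [Module A M] : Prop :=
  ∃ (n : ℕ) (f : M →ₗ[A] (Fin n → A)), Function.Injective f

lemma LinearMap.exists_comp_eq_of_surjective {R A B C : Type*} [Ring R] [AddCommGroup A]
    [AddCommGroup B] [AddCommGroup C] [Module R A] [Module R B] [Module R C] {g : A →ₗ[R] B}
    (hg : Function.Surjective g) (φ : A →ₗ[R] C) (h : LinearMap.ker g ≤ LinearMap.ker φ) :
    ∃ χ : B →ₗ[R] C, χ ∘ₗ g = φ := by
  refine ⟨(LinearMap.ker g).liftQ φ h ∘ₗ (g.quotKerEquivOfSurjective hg).symm, ?_⟩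
  ext x
  have : (g.quotKerEquivOfSurjective hg).symm (g x) = (LinearMap.ker g).mkQ x := by
    rw [LinearEquiv.symm_apply_eq]; rfl
  simp [this]

/-- A resolution by finite free modules, cut into short exact sequences
`0 → X (i + 1) → R ^ rank i → X i → 0`; thus `X i` is an `i`-th syzygy of `X 0`. -/
structure Reso (R : Type) [CommRing R] (X : ℕ → ModuleCat.{0} R) where
  rank : ℕ → ℕ
  cover (i : ℕ) : (Fin (rank i) → R) →ₗ[R] X i
  incl (i : ℕ) : X (i + 1) →ₗ[R] (Fin (rank i) → R)
  cover_surjective (i : ℕ) : Function.Surjective (cover i)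
  incl_injective (i : ℕ) : Function.Injective (incl i)
  exact (i : ℕ) : Function.Exact (incl i) (cover i)

namespace Reso
variable {R : Type} [CommRing R] {X : ℕ → ModuleCat.{0} R} (P : Reso R X)

/-- The free module in degree `i`. -/
abbrev F (i : ℕ) : ModuleCat.{0} R := ModuleCat.of R (Fin (P.rank i) → R)

/-- The differential `F (i + 1) ⟶ F i`. -/
def d (i : ℕ) : P.F (i + 1) ⟶ P.F i := ModuleCat.ofHom (P.incl i ∘ₗ P.cover (i + 1))

lemma d_exact (i : ℕ) : Function.Exact (P.d (i + 1)).hom (P.d i).hom := by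
  intro x
  constructor
  · intro h
    have h0 : P.cover (i + 1) x = 0 := P.incl_injective i (by simpa [d] using h)
    obtain ⟨y, hy⟩ := (P.exact (i + 1) x).1 h0
    obtain ⟨z, rfl⟩ := P.cover_surjective (i + 2) y
    exact ⟨z, hy⟩
  · rintro ⟨z, rfl⟩
    have : P.cover (i + 1) (P.incl (i + 1) (P.cover (i + 2) z)) = 0 :=
      (P.exact (i + 1)).apply_apply_eq_zero _
    simp [d, this]

lemma d_comp_d (i : ℕ) : P.d (i + 1) ≫ P.d i = 0 := by
  ext1
  exact (P.d_exact i).linearMap_comp_eq_zero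

/-- The chain complex of free modules. -/
def complex : ChainComplex (ModuleCat.{0} R) ℕ := ChainComplex.of P.F P.d P.d_comp_d

lemma complex_d (i : ℕ) : P.complex.d (i + 1) i = P.d i := ChainComplex.of_d ..

lemma complex_exactAt_succ (i : ℕ) : P.complex.ExactAt (i + 1) := by
  rw [HomologicalComplex.exactAt_iff' _ (i + 2) (i + 1) i (by simp) (by simp),
    ShortComplex.ShortExact.moduleCat_exact_iff_function_exact]
  simp only [HomologicalComplex.shortComplexFunctor'_obj_f,
    HomologicalComplex.shortComplexFunctor'_obj_g, complex_d]
  exact P.d_exact i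

lemma d_comp_cover : P.d 0 ≫ ModuleCat.ofHom (P.cover 0) = 0 := by
  ext1
  have := (P.exact 0).linearMap_comp_eq_zero
  change P.cover 0 ∘ₗ P.incl 0 ∘ₗ P.cover 1 = 0
  rw [← LinearMap.comp_assoc, this, LinearMap.zero_comp]

/-- The augmented presentation `F 1 ⟶ F 0 ⟶ X 0`. -/
def shortComplex : ShortComplex (ModuleCat.{0} R) := ShortComplex.mk _ _ P.d_comp_cover

lemma shortComplex_exact : P.shortComplex.Exact := by
  rw [ShortComplex.ShortExact.moduleCat_exact_iff_function_exact]
  intro x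
  refine (P.exact 0 x).trans ⟨?_, ?_⟩
  · rintro ⟨y, rfl⟩
    obtain ⟨z, rfl⟩ := P.cover_surjective 1 y
    exact ⟨z, rfl⟩
  · rintro ⟨z, rfl⟩
    exact ⟨P.cover 1 z, rfl⟩

lemma shortComplex_epi : Epi P.shortComplex.g :=
  (ModuleCat.epi_iff_surjective _).2 (P.cover_surjective 0)

/-- The associated projective resolution of `X 0`. -/
def resolution : ProjectiveResolution (X 0) where
  complex := P.complex
  projective n := inferInstanceAs (Projective (P.F n))
  π := (ChainComplex.toSingle₀Equiv _ _).symm ⟨ModuleCat.ofHom (P.cover 0), by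
    rw [complex_d]; exact P.d_comp_cover⟩
  quasiIso := ⟨fun n => by
    cases n
    · rw [ChainComplex.quasiIsoAt₀_iff, ShortComplex.quasiIso_iff_of_zeros']
      · refine (ShortComplex.exact_and_epi_g_iff_of_iso ?_).2
          ⟨P.shortComplex_exact, P.shortComplex_epi⟩
        exact ShortComplex.isoMk (Iso.refl _) (Iso.refl _) (Iso.refl _)
          ((Category.id_comp _).trans ((P.complex_d 0).symm.trans (Category.comp_id _).symm))
          ((Category.id_comp _).trans (Category.comp_id _).symm)
      all_goals rfl
    · rw [quasiIsoAt_iff_exactAt']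
      · exact P.complex_exactAt_succ _
      · apply ChainComplex.exactAt_succ_single_obj⟩

/-- `Ext^(i+1)(X 0, N)` vanishes iff every map from the `(i+1)`-st syzygy to `N` extends to the
free module containing it. -/
lemma ext_iff (i : ℕ) (N : ModuleCat.{0} R) :
    Subsingleton (((Ext R (ModuleCat R) (i + 1)).obj (op (X 0))).obj N) ↔
    ∀ φ : X (i + 1) →ₗ[R] N, ∃ ψ : (Fin (P.rank i) → R) →ₗ[R] N, ψ ∘ₗ P.incl i = φ := by
  rw [← ModuleCat.isZero_iff_subsingleton, (P.resolution.isoExt (R := R) (i + 1) N).isZero_iff,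
    ← HomologicalComplex.exactAt_iff_isZero_homology,
    HomologicalComplex.exactAt_iff' _ i (i + 1) (i + 2) (by simp) (by simp),
    ShortComplex.moduleCat_exact_iff]
  have hd (j : ℕ) : P.resolution.complex.d (j + 1) j = P.d j := P.complex_d j
  constructor
  · intro h φ
    obtain ⟨ψ, hψ⟩ := h (ModuleCat.ofHom (φ ∘ₗ P.cover (i + 1)) : P.F (i + 1) ⟶ N) (by
      change P.resolution.complex.d (i + 2) (i + 1) ≫
        (ModuleCat.ofHom (φ ∘ₗ P.cover (i + 1)) : P.F (i + 1) ⟶ N) = 0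
      rw [hd]
      ext1
      change (φ ∘ₗ P.cover (i + 1)) ∘ₗ P.incl (i + 1) ∘ₗ P.cover (i + 2) = 0
      rw [LinearMap.comp_assoc, ← LinearMap.comp_assoc _ (P.incl (i + 1)),
        (P.exact (i + 1)).linearMap_comp_eq_zero, LinearMap.zero_comp, LinearMap.comp_zero])
    change P.F i ⟶ N at ψ
    change P.resolution.complex.d (i + 1) i ≫ ψ = _ at hψ
    rw [hd] at hψ
    refine ⟨ψ.hom, ?_⟩
    ext x
    obtain ⟨y, rfl⟩ := P.cover_surjective (i + 1) x
    exact congr($hψ y)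
  · intro h x hx
    change P.F (i + 1) ⟶ N at x
    change P.resolution.complex.d (i + 2) (i + 1) ≫ x = 0 at hx
    rw [hd] at hx
    have hker : LinearMap.ker (P.cover (i + 1)) ≤ LinearMap.ker x.hom := by
      intro y hy
      obtain ⟨z, rfl⟩ := (P.exact (i + 1) y).1 hy
      obtain ⟨w, rfl⟩ := P.cover_surjective (i + 2) z
      exact congr($hx w)
    obtain ⟨φ, hφ⟩ := LinearMap.exists_comp_eq_of_surjective
      (P.cover_surjective (i + 1)) x.hom hker
    obtain ⟨ψ, hψ⟩ := h φ
    refine ⟨(ModuleCat.ofHom ψ : P.F i ⟶ N), ?_⟩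
    change P.resolution.complex.d (i + 1) i ≫ (ModuleCat.ofHom ψ : P.F i ⟶ N) = x
    rw [hd]
    ext y
    exact (congr($hψ (P.cover (i + 1) y))).trans congr($hφ y)
end Reso

lemma LinearMap.exists_lift_of_injective {R A B C : Type*} [Ring R] [AddCommGroup A]
    [AddCommGroup B] [AddCommGroup C] [Module R A] [Module R B] [Module R C] {f : A →ₗ[R] B}
    (hf : Function.Injective f) (φ : C →ₗ[R] B) (h : ∀ x, φ x ∈ LinearMap.range f) :
    ∃ χ : C →ₗ[R] A, f ∘ₗ χ = φ := by
  refine ⟨(LinearEquiv.ofInjective f hf).symm ∘ₗ φ.codRestrict _ h, ?_⟩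
  ext x
  have := (LinearEquiv.ofInjective f hf).apply_symm_apply (φ.codRestrict _ h x)
  exact congr($this)

/-- `N` is isomorphic to a direct summand of `X`. -/
def IsRetract (R N X : Type*) [Ring R] [AddCommGroup N] [AddCommGroup X] [Module R N]
    [Module R X] : Prop :=
  ∃ (s : N →ₗ[R] X) (r : X →ₗ[R] N), r ∘ₗ s = LinearMap.id

lemma IsRetract.subsingleton {R N X : Type*} [Ring R] [AddCommGroup N] [AddCommGroup X]
    [Module R N] [Module R X] (h : IsRetract R N X) [Subsingleton X] : Subsingleton N := by
  obtain ⟨s, r, hrs⟩ := h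
  exact (Function.LeftInverse.injective fun x => congr($hrs x) : Function.Injective s).subsingleton

namespace Reso
variable {R : Type} [CommRing R] {X : ℕ → ModuleCat.{0} R} (P : Reso R X)

/-- The vanishing of `Ext^(i + 1)(X 0, N)`, in terms of a resolution of `X 0`. -/
def Extends (i : ℕ) (N : Type) [AddCommGroup N] [Module R N] : Prop :=
  ∀ φ : X (i + 1) →ₗ[R] N, ∃ ψ : (Fin (P.rank i) → R) →ₗ[R] N, ψ ∘ₗ P.incl i = φ

variable {P} {N N' N'' : Type} [AddCommGroup N] [Module R N] [AddCommGroup N'] [Module R N']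
  [AddCommGroup N''] [Module R N''] {i : ℕ}

lemma Extends.of_retract (h : P.Extends i N) (hr : IsRetract R N' N) : P.Extends i N' := by
  obtain ⟨s, r, hrs⟩ := hr
  intro φ
  obtain ⟨ψ, hψ⟩ := h (s ∘ₗ φ)
  exact ⟨r ∘ₗ ψ, by rw [LinearMap.comp_assoc, hψ, ← LinearMap.comp_assoc, hrs, LinearMap.id_comp]⟩

lemma Extends.prod (h : P.Extends i N) (h' : P.Extends i N') : P.Extends i (N × N') := by
  intro φ
  obtain ⟨ψ, hψ⟩ := h (LinearMap.fst R N N' ∘ₗ φ)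
  obtain ⟨ψ', hψ'⟩ := h' (LinearMap.snd R N N' ∘ₗ φ)
  exact ⟨ψ.prod ψ', LinearMap.ext fun x => Prod.ext congr($hψ x) congr($hψ' x)⟩

lemma Extends.pi {ι : Type} (h : P.Extends i N) : P.Extends i (ι → N) := by
  intro φ
  choose ψ hψ using fun t : ι => h (LinearMap.proj t ∘ₗ φ)
  exact ⟨LinearMap.pi ψ, LinearMap.ext fun x => funext fun t => congr($(hψ t) x)⟩

lemma Extends.of_exact_right {f : N' →ₗ[R] N} {g : N →ₗ[R] N''} (hf : Function.Injective f)
    (hg : Function.Surjective g) (hfg : Function.Exact f g) (h : P.Extends i N)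
    (h' : P.Extends (i + 1) N') : P.Extends i N'' := by
  intro φ
  obtain ⟨u, hu⟩ := Module.projective_lifting_property g (φ ∘ₗ P.cover (i + 1)) hg
  obtain ⟨χ, hχ⟩ := LinearMap.exists_lift_of_injective hf (u ∘ₗ P.incl (i + 1)) fun x => by
    refine (hfg _).1 ?_
    have := congr($hu (P.incl (i + 1) x))
    simpa [(P.exact (i + 1)).apply_apply_eq_zero] using this
  obtain ⟨χ', hχ'⟩ := h' χ
  obtain ⟨v, hv⟩ := LinearMap.exists_comp_eq_of_surjective (P.cover_surjective (i + 1))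
    (u - f ∘ₗ χ') (by
      intro y hy
      obtain ⟨z, rfl⟩ := (P.exact (i + 1) y).1 hy
      have h1 := congr($hχ z)
      have h2 := congr($hχ' z)
      simp only [LinearMap.comp_apply] at h1 h2
      simp [h2, h1])
  obtain ⟨ψ, hψ⟩ := h v
  refine ⟨g ∘ₗ ψ, ?_⟩
  rw [LinearMap.comp_assoc, hψ]
  ext x
  obtain ⟨y, rfl⟩ := P.cover_surjective (i + 1) x
  have h1 := congr($hv y)
  have h2 := congr($hu y)
  simp only [LinearMap.comp_apply] at h1 h2
  simp [h1, h2, hfg.apply_apply_eq_zero]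

lemma Extends.of_exact_left {f : N' →ₗ[R] N} {g : N →ₗ[R] N''} (hf : Function.Injective f)
    (hg : Function.Surjective g) (hfg : Function.Exact f g) (h : P.Extends (i + 1) N)
    (h' : P.Extends i N'') : P.Extends (i + 1) N' := by
  intro φ
  obtain ⟨u, hu⟩ := h (f ∘ₗ φ)
  obtain ⟨v, hv⟩ := LinearMap.exists_comp_eq_of_surjective (P.cover_surjective (i + 1))
    (g ∘ₗ u) (by
      intro y hy
      obtain ⟨z, rfl⟩ := (P.exact (i + 1) y).1 hy
      have h1 := congr($hu z)
      simp only [LinearMap.comp_apply] at h1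
      simp [h1, hfg.apply_apply_eq_zero])
  obtain ⟨w, hw⟩ := h' v
  obtain ⟨w', hw'⟩ := Module.projective_lifting_property g w hg
  obtain ⟨χ, hχ⟩ := LinearMap.exists_lift_of_injective hf
    (u - w' ∘ₗ P.incl i ∘ₗ P.cover (i + 1)) fun x => by
      refine (hfg _).1 ?_
      have h1 := congr($hv x)
      have h2 := congr($hw (P.cover (i + 1) x))
      have h3 := congr($hw' (P.incl i (P.cover (i + 1) x)))
      simp only [LinearMap.comp_apply] at h1 h2 h3
      simp [h1, h2, h3]
  refine ⟨χ, LinearMap.ext fun x => hf ?_⟩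
  have h1 := congr($hχ (P.incl (i + 1) x))
  have h2 := congr($hu x)
  simp only [LinearMap.comp_apply] at h1 h2
  simp [h1, h2, (P.exact (i + 1)).apply_apply_eq_zero]

open Filter in
lemma eventually_extends_syzygy (h : ∀ᶠ i in atTop, P.Extends i (X 0))
    (hR : ∀ᶠ i in atTop, P.Extends i R) (j : ℕ) : ∀ᶠ i in atTop, P.Extends i (X j) := by
  induction j with
  | zero => exact h
  | succ j ih =>
    obtain ⟨a, ha⟩ := eventually_atTop.1 (ih.and hR)
    refine eventually_atTop.2 ⟨a + 1, fun b hb => ?_⟩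
    obtain ⟨b, rfl⟩ : ∃ c, b = c + 1 := ⟨b - 1, by omega⟩
    exact .of_exact_left (P.incl_injective j) (P.cover_surjective j) (P.exact j)
      (ha (b + 1) (by omega)).2.pi (ha b (by omega)).1

end Reso

section Local

variable {R : Type} [CommRing R] [IsLocalRing R]

lemma map_mem_maximalIdeal_smul {N : Type*} [AddCommGroup N] [Module R N] {n : ℕ}
    (ψ : (Fin n → R) →ₗ[R] N) {v : Fin n → R} (hv : ∀ t, v t ∈ maximalIdeal R) :
    ψ v ∈ maximalIdeal R • (⊤ : Submodule R N) := by
  rw [LinearMap.pi_apply_eq_sum_univ ψ v]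
  exact Submodule.sum_mem _ fun t _ => Submodule.smul_mem_smul (hv t) trivial

lemma exists_notMem_maximalIdeal_smul {N : Type*} [AddCommGroup N] [Module R N]
    [Module.Finite R N] [Nontrivial N] : ∃ x : N, x ∉ maximalIdeal R • (⊤ : Submodule R N) := by
  by_contra! h
  refine (bot_ne_top : (⊥ : Submodule R N) ≠ ⊤) (Eq.symm ?_)
  exact Submodule.eq_bot_of_le_smul_of_le_jacobson_bot (maximalIdeal R) ⊤ Module.Finite.fg_top
    (fun x _ => h x) (IsLocalRing.maximalIdeal_le_jacobson _)

lemma exists_minimal_cover (M : Type*) [AddCommGroup M] [Module R M] [Module.Finite R M] :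
    ∃ (n : ℕ) (f : (Fin n → R) →ₗ[R] M), Function.Surjective f ∧
      ∀ x, f x = 0 → ∀ t, x t ∈ maximalIdeal R := by
  classical
  obtain ⟨n, ⟨f, hf⟩, hmin⟩ : ∃ n : ℕ, (∃ f : (Fin n → R) →ₗ[R] M, Function.Surjective f) ∧
      ∀ m < n, ¬ ∃ f : (Fin m → R) →ₗ[R] M, Function.Surjective f :=
    have hex := Module.Finite.exists_fin' R M
    ⟨Nat.find hex, Nat.find_spec hex, fun _ => Nat.find_min hex⟩
  refine ⟨n, f, hf, fun x hx t => ?_⟩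
  by_contra ht
  obtain _ | n := n
  · exact t.elim0
  obtain ⟨u, hu⟩ : IsUnit (x t) := by simpa using ht
  refine hmin n n.lt_succ_self ⟨f ∘ₗ Function.ExtendByZero.linearMap R t.succAbove, fun y => ?_⟩
  obtain ⟨z, rfl⟩ := hf y
  let z' := z - (z t * ↑u⁻¹) • x
  have hz' : z' t = 0 := by simp [z', ← hu]
  refine ⟨z' ∘ t.succAbove, ?_⟩
  have : Function.ExtendByZero.linearMap R t.succAbove (z' ∘ t.succAbove) = z' := by
    ext a
    obtain rfl | ⟨b, rfl⟩ := t.eq_self_or_eq_succAbove a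
    · rw [hz']
      exact Function.extend_apply' _ _ _ fun ⟨b, hb⟩ => Fin.succAbove_ne _ b hb
    · exact (Fin.succAbove_right_injective).extend_apply _ _ _
  rw [LinearMap.comp_apply, this]
  simp [z', hx]

/-- The entries of the differentials lie in the maximal ideal. -/
def Reso.Minimal {X : ℕ → ModuleCat.{0} R} (P : Reso R X) : Prop :=
  ∀ i x t, P.incl i x t ∈ maximalIdeal R

/-- The iterated kernels of minimal free covers, starting from `M`. -/
def syzygies [IsNoetherianRing R] (M : ModuleCat.{0} R) [Module.Finite R M] :
    ℕ → {X : ModuleCat.{0} R // Module.Finite R X}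
  | 0 => ⟨M, inferInstance⟩
  | i + 1 =>
    haveI := (syzygies M i).2
    let f := (exists_minimal_cover (R := R) (syzygies M i).1).choose_spec.choose
    ⟨ModuleCat.of R (LinearMap.ker f), inferInstanceAs (Module.Finite R (LinearMap.ker f))⟩

lemma exists_minimal_resolution [IsNoetherianRing R] (M : ModuleCat.{0} R) [Module.Finite R M] :
    ∃ X : ℕ → ModuleCat.{0} R, X 0 = M ∧ (∀ i, Module.Finite R (X i)) ∧
      ∃ P : Reso R X, P.Minimal := by
  have hfin (i : ℕ) := (syzygies M i).2
  have hspec (i : ℕ) := (exists_minimal_cover (R := R) (syzygies M i).1).choose_spec.choose_spec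
  refine ⟨fun i => (syzygies M i).1, rfl, hfin,
    { rank := fun i => (exists_minimal_cover (R := R) (syzygies M i).1).choose
      cover := fun i => (exists_minimal_cover (R := R) (syzygies M i).1).choose_spec.choose
      incl := fun i => (LinearMap.ker _).subtype
      cover_surjective := fun i => (hspec i).1
      incl_injective := fun i => Subtype.val_injective
      exact := fun i => LinearMap.exact_subtype_ker_map _ }, fun i x t => (hspec i).2 _ x.2 t⟩

namespace Reso

variable {X : ℕ → ModuleCat.{0} R} {P : Reso R X}

lemma Minimal.subsingleton_of_extends (hP : P.Minimal) {i : ℕ} [Module.Finite R (X (i + 1))]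
    (h : P.Extends i (R ⧸ maximalIdeal R)) : Subsingleton (X (i + 1)) := by
  by_contra hX
  rw [not_subsingleton_iff_nontrivial] at hX
  obtain ⟨N, hN, -⟩ :=
    (eq_top_or_exists_le_coatom (⊥ : Submodule R (X (i + 1)))).resolve_left bot_ne_top
  obtain ⟨L, hL, ⟨e⟩⟩ :=
    isSimpleModule_iff_quot_maximal.1 (isSimpleModule_iff_isCoatom.2 hN)
  obtain rfl := IsLocalRing.eq_maximalIdeal hL
  obtain ⟨ψ, hψ⟩ := h (e.toLinearMap ∘ₗ N.mkQ)
  refine hN.1 (eq_top_iff.2 fun x _ => ?_)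
  rw [← Submodule.Quotient.mk_eq_zero, ← Submodule.mkQ_apply, ← e.map_eq_zero_iff]
  refine (congr($hψ x)).symm.trans ?_
  have hx := map_mem_maximalIdeal_smul ψ (hP i x)
  have hbot : maximalIdeal R • (⊤ : Submodule R (R ⧸ maximalIdeal R)) = ⊥ := by
    rw [← Submodule.le_annihilator_iff, Submodule.annihilator_top, Ideal.annihilator_quotient]
  rwa [hbot] at hx

lemma Minimal.subsingleton_succ (hP : P.Minimal) {i : ℕ} (h : Subsingleton (X i)) :
    Subsingleton (X (i + 1)) := by
  have : IsEmpty (Fin (P.rank i)) := ⟨fun t => by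
    obtain ⟨x, hx⟩ := (P.exact i (Pi.single t 1)).1 (Subsingleton.elim _ _)
    have := hP i x t
    rw [hx, Pi.single_eq_same] at this
    exact (Ideal.ne_top_iff_one _).1 (maximalIdeal.isMaximal R).ne_top this⟩
  exact (P.incl_injective i).subsingleton

lemma Minimal.subsingleton_of_le (hP : P.Minimal) {i j : ℕ} (hij : i ≤ j)
    (h : Subsingleton (X i)) : Subsingleton (X j) := by
  induction j, hij using Nat.le_induction with
  | base => exact h
  | succ j _ ih => exact hP.subsingleton_succ ih

omit [IsLocalRing R] in
lemma cover_bijective {i : ℕ} (h : Subsingleton (X (i + 1))) : Function.Bijective (P.cover i) := by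
  refine ⟨(injective_iff_map_eq_zero _).2 fun x hx => ?_, P.cover_surjective i⟩
  obtain ⟨y, rfl⟩ := (P.exact i x).1 hx
  rw [Subsingleton.elim y 0, map_zero]

lemma Minimal.subsingleton_one (hP : P.Minimal) (h : Subsingleton (X 2)) (hR : P.Extends 0 R) :
    Subsingleton (X 1) := by
  let e := LinearEquiv.ofBijective (P.cover 1) (P.cover_bijective h)
  have : IsEmpty (Fin (P.rank 1)) := ⟨fun t => by
    obtain ⟨ψ, hψ⟩ := hR (LinearMap.proj t ∘ₗ e.symm.toLinearMap)
    have h1 : ψ (P.incl 0 (e (Pi.single t 1))) = 1 := by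
      rw [← LinearMap.comp_apply, hψ]; simp
    have h2 := map_mem_maximalIdeal_smul ψ (hP 0 (e (Pi.single t 1)))
    rw [h1, smul_eq_mul, Ideal.mul_top] at h2
    exact (Ideal.ne_top_iff_one _).1 (maximalIdeal.isMaximal R).ne_top h2⟩
  exact e.symm.injective.subsingleton

variable {I J : Ideal R}

omit [IsLocalRing R] in
lemma coprod_subtype_injective (hinf : I ⊓ J = ⊥) :
    Function.Injective (I.subtype.coprod J.subtype) := by
  rw [← LinearMap.ker_eq_bot, LinearMap.ker_coprod_of_disjoint_range, Submodule.ker_subtype,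
    Submodule.ker_subtype, Submodule.prod_bot]
  simpa [disjoint_iff] using hinf

lemma exists_maximalIdeal_proj (hsup : I ⊔ J = maximalIdeal R) (hinf : I ⊓ J = ⊥) :
    ∃ p : maximalIdeal R →ₗ[R] J, ∀ (x : maximalIdeal R) (hx : (x : R) ∈ J), p x = ⟨x, hx⟩ := by
  have hinj := coprod_subtype_injective hinf
  obtain ⟨χ, hχ⟩ := LinearMap.exists_lift_of_injective hinj (maximalIdeal R).subtype fun x => by
    rw [LinearMap.range_coprod, Submodule.range_subtype, Submodule.range_subtype, hsup]
    exact x.2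
  refine ⟨LinearMap.snd R I J ∘ₗ χ, fun x hx => ?_⟩
  have : χ x = (0, ⟨x, hx⟩) := hinj ((congr($hχ x)).trans (by simp))
  simp [this]

/-- If `J` kills a minimal generator of `X i`, then `J` is a summand of the next syzygy. -/
lemma Minimal.isRetract (hP : P.Minimal) (hsup : I ⊔ J = maximalIdeal R) (hinf : I ⊓ J = ⊥)
    {i : ℕ} {x : X i} (hx : x ∉ maximalIdeal R • (⊤ : Submodule R (X i)))
    (hJx : ∀ a ∈ J, a • x = 0) : IsRetract R J (X (i + 1)) := by
  obtain ⟨p, hp⟩ := exists_maximalIdeal_proj hsup hinf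
  obtain ⟨e, rfl⟩ := P.cover_surjective i x
  obtain ⟨t, ht⟩ : ∃ t, e t ∉ maximalIdeal R := by
    by_contra! h
    exact hx (map_mem_maximalIdeal_smul _ h)
  obtain ⟨u, hu⟩ : IsUnit (e t) := by simpa using ht
  obtain ⟨s, hs⟩ := LinearMap.exists_lift_of_injective (P.incl_injective i)
    (LinearMap.toSpanSingleton R _ e ∘ₗ J.subtype) fun a => by
      refine (P.exact i _).1 ?_
      simpa only [LinearMap.comp_apply, Submodule.subtype_apply, LinearMap.toSpanSingleton_apply,
        map_smul] using hJx a a.2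
  refine ⟨s, (↑u⁻¹ : R) • p ∘ₗ (LinearMap.proj t ∘ₗ P.incl i).codRestrict _ fun y => hP i y t, ?_⟩
  ext a
  have h1 := congr($hs a t)
  simp only [LinearMap.comp_apply, LinearMap.toSpanSingleton_apply, Submodule.subtype_apply,
    Pi.smul_apply, smul_eq_mul] at h1
  have h2 := hp ⟨P.incl i (s a) t, hP i (s a) t⟩
    (h1.symm.subst (motive := (· ∈ J)) (J.mul_mem_right _ a.2))
  refine (congrArg (fun b : J => (↑u⁻¹ : R) * (b : R)) h2).trans ?_
  simp only [h1, ← hu]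
  rw [mul_comm, mul_assoc, Units.mul_inv, mul_one]
  rfl

lemma exists_killed_of_isRetract [IsNoetherianRing R] (hinf : I ⊓ J = ⊥) (hJ : J ≠ ⊥) {N : Type*}
    [AddCommGroup N] [Module R N] (h : IsRetract R J N) :
    ∃ x ∉ maximalIdeal R • (⊤ : Submodule R N), ∀ a ∈ I, a • x = 0 := by
  obtain ⟨s, r, hrs⟩ := h
  have : Nontrivial J := Submodule.nontrivial_iff_ne_bot.2 hJ
  obtain ⟨y, hy⟩ := exists_notMem_maximalIdeal_smul (R := R) (N := J)
  refine ⟨s y, fun hs => hy ?_, fun a ha => ?_⟩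
  · have := Submodule.mem_map_of_mem (f := r) hs
    rw [Submodule.map_smul''] at this
    have h1 : r (s y) = y := congr($hrs y)
    rw [h1] at this
    exact Submodule.smul_mono le_rfl le_top this
  · rw [← map_smul]
    have : a • y = 0 := by
      ext
      have : a * y ∈ I ⊓ J := ⟨I.mul_mem_right _ ha, J.mul_mem_left _ y.2⟩
      simpa [hinf] using this
    rw [this, map_zero]

/-- The second syzygy is the sum of its parts inside `I ^ n` and `J ^ n`, so it has a minimal
generator killed by `I` or by `J`. -/
lemma Minimal.exists_killed (hP : P.Minimal) [Module.Finite R (X 2)] [Nontrivial (X 2)]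
    (hsup : I ⊔ J = maximalIdeal R) (hinf : I ⊓ J = ⊥) :
    ∃ x ∉ maximalIdeal R • (⊤ : Submodule R (X 2)),
      (∀ a ∈ I, a • x = 0) ∨ ∀ a ∈ J, a • x = 0 := by
  obtain ⟨x, hx⟩ := exists_notMem_maximalIdeal_smul (R := R) (N := X 2)
  have hmem (t) : ∃ a ∈ I, ∃ b ∈ J, a + b = P.incl 1 x t :=
    Submodule.mem_sup.1 (hsup ▸ hP 1 x t)
  choose a ha b hb hab using hmem
  have hab' : a + b = P.incl 1 x := funext hab
  have key (c : Fin (P.rank 1) → R) (L : Ideal R) (hc : ∀ t, c t ∈ L) (t) :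
      P.incl 0 (P.cover 1 c) t ∈ L := by
    have := LinearMap.pi_apply_eq_sum_univ (LinearMap.proj t ∘ₗ P.incl 0 ∘ₗ P.cover 1) c
    simp only [LinearMap.comp_apply, LinearMap.proj_apply] at this
    rw [this]
    exact L.sum_mem fun s _ => L.mul_mem_right _ (hc s)
  have hsum : P.cover 1 a + P.cover 1 b = 0 := by
    rw [← map_add, hab', (P.exact 1).apply_apply_eq_zero]
  have ha0 : P.cover 1 a = 0 := by
    refine P.incl_injective 0 (funext fun t => ?_)
    have h2 : P.incl 0 (P.cover 1 a) t ∈ J := by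
      rw [eq_neg_of_add_eq_zero_left hsum, map_neg]
      exact J.neg_mem (key b J hb t)
    have : P.incl 0 (P.cover 1 a) t ∈ I ⊓ J := ⟨key a I ha t, h2⟩
    simpa [hinf] using this
  have hb0 : P.cover 1 b = 0 := by rwa [ha0, zero_add] at hsum
  obtain ⟨y, hy⟩ := (P.exact 1 a).1 ha0
  obtain ⟨z, hz⟩ := (P.exact 1 b).1 hb0
  have hxyz : y + z = x := P.incl_injective 1 (by rw [map_add, hy, hz, hab'])
  have kill (w : X 2) (K L : Ideal R) (hKL : K ⊓ L = ⊥) (hw : ∀ t, P.incl 1 w t ∈ L) :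
      ∀ c ∈ K, c • w = 0 := fun c hc => P.incl_injective 1 (funext fun t => by
    have : c * P.incl 1 w t ∈ K ⊓ L := ⟨K.mul_mem_right _ hc, L.mul_mem_left _ (hw t)⟩
    simpa [hKL] using this)
  by_cases hy' : y ∈ maximalIdeal R • (⊤ : Submodule R (X 2))
  · refine ⟨z, fun hz' => hx (hxyz ▸ Submodule.add_mem _ hy' hz'), .inl ?_⟩
    exact kill z I J hinf fun t => hz ▸ hb t
  · refine ⟨y, hy', .inr ?_⟩
    exact kill y J I (inf_comm J I ▸ hinf) fun t => hy ▸ ha t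

open Filter in
theorem Minimal.subsingleton_two [IsNoetherianRing R] [∀ i, Module.Finite R (X i)]
    (hP : P.Minimal) (hsup : I ⊔ J = maximalIdeal R) (hinf : I ⊓ J = ⊥) (hI : I ≠ ⊥)
    (hJ : J ≠ ⊥) (h : ∀ᶠ i in atTop, P.Extends i (X 0)) (hR : ∀ᶠ i in atTop, P.Extends i R) :
    Subsingleton (X 2) := by
  by_contra hX
  have hX' := not_subsingleton_iff_nontrivial.1 hX
  have hsup' := sup_comm I J ▸ hsup
  have hinf' := inf_comm I J ▸ hinf
  have hstepI (i : ℕ) (h : IsRetract R I (X i)) : IsRetract R J (X (i + 1)) :=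
    have ⟨_, hx, hJx⟩ := exists_killed_of_isRetract hinf' hI h
    hP.isRetract hsup hinf hx hJx
  have hstepJ (i : ℕ) (h : IsRetract R J (X i)) : IsRetract R I (X (i + 1)) :=
    have ⟨_, hx, hIx⟩ := exists_killed_of_isRetract hinf hJ h
    hP.isRetract hsup' hinf' hx hIx
  have hretract (i : ℕ) : IsRetract R I (X (i + 3)) ∨ IsRetract R J (X (i + 3)) := by
    induction i with
    | zero =>
      obtain ⟨x, hx, hxI | hxJ⟩ := hP.exists_killed hsup hinf
      · exact .inl (hP.isRetract hsup' hinf' hx hxI)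
      · exact .inr (hP.isRetract hsup hinf hx hxJ)
    | succ i ih => exact ih.elim (fun h => .inr (hstepI _ h)) fun h => .inl (hstepJ _ h)
  obtain ⟨a, b, hIa, hJb⟩ : ∃ a b, IsRetract R I (X a) ∧ IsRetract R J (X b) :=
    (hretract 0).elim (fun h => ⟨3, 4, h, hstepI _ h⟩) fun h => ⟨4, 3, hstepJ _ h, h⟩
  have hIJ : ∀ᶠ i in atTop, P.Extends i (I × J) :=
    (eventually_extends_syzygy h hR a).mp <| (eventually_extends_syzygy h hR b).mono
      fun _ hb ha => (ha.of_retract hIa).prod (hb.of_retract hJb)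
  have hexact : Function.Exact (I.subtype.coprod J.subtype) (maximalIdeal R).mkQ := by
    rw [LinearMap.exact_iff, Submodule.ker_mkQ, LinearMap.range_coprod, Submodule.range_subtype,
      Submodule.range_subtype]
    exact hsup.symm
  obtain ⟨n, hn⟩ := eventually_atTop.1 (hIJ.and hR)
  have hk : P.Extends (n + 1) (R ⧸ maximalIdeal R) :=
    .of_exact_right (coprod_subtype_injective hinf) (Submodule.mkQ_surjective _) hexact
      (hn (n + 1) (by omega)).2 (hn (n + 2) (by omega)).1
  have hsub : Subsingleton (X (n + 3)) :=
    hP.subsingleton_succ (hP.subsingleton_of_extends hk)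
  obtain h | h := hretract n
  · exact hI (Submodule.subsingleton_iff_eq_bot.1 h.subsingleton)
  · exact hJ (Submodule.subsingleton_iff_eq_bot.1 h.subsingleton)

end Reso

open Filter in
theorem pdLE_one_and_free_of_ext_eq_zero [IsNoetherianRing R] {I J : Ideal R}
    (hsup : I ⊔ J = maximalIdeal R) (hinf : I ⊓ J = ⊥) (hI : I ≠ ⊥) (hJ : J ≠ ⊥)
    (M : ModuleCat.{0} R) [Module.Finite R M] :
    ((∃ n : ℕ, ∀ i ≥ n, ExtZero R M (M × R) i) → PdLE R M 1) ∧
      ((∀ i ≥ 1, ExtZero R M (M × R) i) → Module.Free R M) := by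
  obtain ⟨X, rfl, hfin, P, hP⟩ := exists_minimal_resolution M
  have hfst : IsRetract R (X 0) (X 0 × R) :=
    ⟨LinearMap.inl R _ _, LinearMap.fst R _ _, LinearMap.fst_comp_inl R _ _⟩
  have hsnd : IsRetract R R (X 0 × R) :=
    ⟨LinearMap.inr R _ _, LinearMap.snd R _ _, LinearMap.snd_comp_inr R _ _⟩
  have key (h : ∃ n : ℕ, ∀ i ≥ n, ExtZero R (X 0) (X 0 × R) i) : Subsingleton (X 2) := by
    obtain ⟨n, hn⟩ := h
    have hext : ∀ᶠ i in atTop, P.Extends i (X 0 × R) :=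
      eventually_atTop.2 ⟨n, fun i hi => (P.ext_iff i (.of R (X 0 × R))).1 (hn (i + 1) (by omega))⟩
    exact hP.subsingleton_two hsup hinf hI hJ (hext.mono fun _ h => h.of_retract hfst)
      (hext.mono fun _ h => h.of_retract hsnd)
  refine ⟨fun h N i hi => ?_, fun h => ?_⟩
  · obtain ⟨i, rfl⟩ : ∃ j, i = j + 1 := ⟨i - 1, by omega⟩
    refine (P.ext_iff i N).2 fun φ => ⟨0, ?_⟩
    have := hP.subsingleton_of_le (show 2 ≤ i + 1 by omega) (key h)
    exact LinearMap.ext fun x => by rw [Subsingleton.elim x 0, map_zero, map_zero]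
  · have hR : P.Extends 0 R :=
      Reso.Extends.of_retract ((P.ext_iff 0 (.of R (X 0 × R))).1 (h 1 le_rfl)) hsnd
    have h1 := hP.subsingleton_one (key ⟨1, h⟩) hR
    exact Module.Free.of_equiv (LinearEquiv.ofBijective (P.cover 0) (P.cover_bijective h1))

end Local

lemma isNoetherian_of_algebraMap_surjective {A B : Type*} [CommRing A] [CommRing B] [Algebra A B]
    [IsNoetherianRing B] (h : Function.Surjective (algebraMap A B)) : IsNoetherian A B := by
  refine isNoetherian_def.2 fun N => ?_
  let N' : Ideal B :=
    { N with
      smul_mem' := fun b x hx => by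
        obtain ⟨a, rfl⟩ := h b
        rw [← algebra_compatible_smul]
        exact N.smul_mem a hx }
  obtain ⟨s, hs⟩ := (isNoetherianRing_iff_ideal_fg B).1 inferInstance N'
  refine ⟨s, ?_⟩
  rw [← Submodule.restrictScalars_span A B h]
  exact SetLike.coe_injective (congrArg (fun L : Ideal B => (L : Set B)) hs)

section FiberProduct

variable {S T k : Type} [CommRing S] [CommRing T] [Field k] (πS : S →+* k) (πT : T →+* k)

lemma ρS_surjective (hπT : Function.Surjective πT) : Function.Surjective (ρS πS πT) := fun s =>
  have ⟨t, ht⟩ := hπT (πS s)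
  ⟨⟨(s, t), ht.symm⟩, rfl⟩

lemma ρT_surjective (hπS : Function.Surjective πS) : Function.Surjective (ρT πS πT) := fun t =>
  have ⟨s, hs⟩ := hπS (πT t)
  ⟨⟨(s, t), hs⟩, rfl⟩

lemma fiberProd_isNoetherianRing [IsNoetherianRing S] [IsNoetherianRing T]
    (hπS : Function.Surjective πS) (hπT : Function.Surjective πT) :
    IsNoetherianRing (fiberProd πS πT) := by
  let _ := (ρS πS πT).toAlgebra
  let _ := (ρT πS πT).toAlgebra
  have : IsNoetherian (fiberProd πS πT) S :=
    isNoetherian_of_algebraMap_surjective (ρS_surjective πS πT hπT)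
  have : IsNoetherian (fiberProd πS πT) T :=
    isNoetherian_of_algebraMap_surjective (ρT_surjective πS πT hπS)
  let f : fiberProd πS πT →ₗ[fiberProd πS πT] S × T :=
    { toFun := fun x => x
      map_add' := fun _ _ => rfl
      map_smul' := fun _ _ => rfl }
  exact isNoetherian_of_injective f Subtype.val_injective

variable {πS πT}

lemma fiberProd_isUnit_iff [IsLocalRing S] [IsLocalRing T]
    (hkS : RingHom.ker πS = maximalIdeal S) (hkT : RingHom.ker πT = maximalIdeal T)
    (x : fiberProd πS πT) : IsUnit x ↔ πS (ρS πS πT x) ≠ 0 := by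
  refine ⟨fun h => (h.map (πS.comp (ρS πS πT))).ne_zero, fun h => ?_⟩
  obtain ⟨⟨s, t⟩, hst⟩ := x
  change πS s = πT t at hst
  change πS s ≠ 0 at h
  obtain ⟨u, rfl⟩ : IsUnit s := by
    rwa [Ne, ← RingHom.mem_ker, hkS, mem_maximalIdeal, mem_nonunits_iff, not_not] at h
  obtain ⟨v, rfl⟩ : IsUnit t := by
    rwa [hst, Ne, ← RingHom.mem_ker, hkT, mem_maximalIdeal, mem_nonunits_iff, not_not] at h
  have hinv : πS ↑u⁻¹ = πT ↑v⁻¹ := by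
    refine mul_left_cancel₀ h ?_
    rw [← map_mul, hst, ← map_mul, Units.mul_inv, Units.mul_inv, map_one, map_one]
  exact IsUnit.of_mul_eq_one ⟨(↑u⁻¹, ↑v⁻¹), hinv⟩
    (Subtype.ext (Prod.ext (Units.mul_inv u) (Units.mul_inv v)))

lemma fiberProd_isLocalRing [IsLocalRing S] [IsLocalRing T]
    (hkS : RingHom.ker πS = maximalIdeal S) (hkT : RingHom.ker πT = maximalIdeal T) :
    IsLocalRing (fiberProd πS πT) :=
  have : IsLocalHom (πS.comp (ρS πS πT)) :=
    ⟨fun x hx => (fiberProd_isUnit_iff hkS hkT x).2 hx.ne_zero⟩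
  (πS.comp (ρS πS πT)).domain_isLocalRing

lemma ker_sup_ker_eq_maximalIdeal [IsLocalRing S] [IsLocalRing T] [IsLocalRing (fiberProd πS πT)]
    (hkS : RingHom.ker πS = maximalIdeal S) (hkT : RingHom.ker πT = maximalIdeal T) :
    RingHom.ker (ρT πS πT) ⊔ RingHom.ker (ρS πS πT) = maximalIdeal (fiberProd πS πT) := by
  have hmem (x : fiberProd πS πT) :
      x ∈ maximalIdeal (fiberProd πS πT) ↔ πS (ρS πS πT x) = 0 := by
    rw [mem_maximalIdeal, mem_nonunits_iff, fiberProd_isUnit_iff hkS hkT, not_not]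
  refine le_antisymm (sup_le (fun x hx => ?_) fun x hx => ?_) fun x hx => ?_
  · have h1 : πS (ρS πS πT x) = πT (ρT πS πT x) := x.2
    rw [hmem, h1, (RingHom.mem_ker.1 hx), map_zero]
  · rw [hmem, (RingHom.mem_ker.1 hx), map_zero]
  · rw [hmem] at hx
    have h1 : πS (ρS πS πT x) = πT (ρT πS πT x) := x.2
    refine Submodule.mem_sup.2 ⟨⟨(ρS πS πT x, 0), hx.trans (map_zero πT).symm⟩, rfl,
      ⟨(0, ρT πS πT x), (map_zero πS).trans (hx.symm.trans h1)⟩, rfl, ?_⟩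
    exact Subtype.ext (Prod.ext (add_zero _) (zero_add _))

lemma ker_inf_ker_eq_bot : RingHom.ker (ρT πS πT) ⊓ RingHom.ker (ρS πS πT) = ⊥ :=
  (Submodule.eq_bot_iff _).2 fun _ hx => Subtype.ext (Prod.ext hx.2 hx.1)

lemma ker_ρT_ne_bot [IsLocalRing S] (hkS : RingHom.ker πS = maximalIdeal S)
    (hS : maximalIdeal S ≠ ⊥) : RingHom.ker (ρT πS πT) ≠ ⊥ := by
  obtain ⟨s, hs, hs0⟩ := Submodule.exists_mem_ne_zero_of_ne_bot hS
  have hmem : πS s = πT 0 := by rw [map_zero]; exact (hkS ▸ hs : s ∈ RingHom.ker πS)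
  refine (Submodule.ne_bot_iff _).2 ⟨⟨(s, 0), hmem⟩, rfl, fun h => hs0 ?_⟩
  exact congr((($h : fiberProd πS πT) : S × T).1)

lemma ker_ρS_ne_bot [IsLocalRing T] (hkT : RingHom.ker πT = maximalIdeal T)
    (hT : maximalIdeal T ≠ ⊥) : RingHom.ker (ρS πS πT) ≠ ⊥ := by
  obtain ⟨t, ht, ht0⟩ := Submodule.exists_mem_ne_zero_of_ne_bot hT
  have hmem : πS 0 = πT t := by
    rw [map_zero]; exact Eq.symm (hkT ▸ ht : t ∈ RingHom.ker πT)
  refine (Submodule.ne_bot_iff _).2 ⟨⟨(0, t), hmem⟩, rfl, fun h => ht0 ?_⟩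
  exact congr((($h : fiberProd πS πT) : S × T).2)

end FiberProduct

/-- Theorem 4.5: over the fiber product `R = S ×ₖ T`: (a) if `Ext^i_R(M, M ⊕ R) = 0` for
all `i ≫ 0` then `pd_R M ≤ 1`; (b) if `Ext^i_R(M, M ⊕ R) = 0` for all `i ≥ 1` then `M`
is free.  In particular `R` satisfies the Auslander–Reiten Conjecture. -/
theorem stmt_17 (S T k : Type) [CommRing S] [CommRing T] [Field k]
    [IsNoetherianRing S] [IsNoetherianRing T] [IsLocalRing S] [IsLocalRing T]
    (πS : S →+* k) (πT : T →+* k)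
    (hπS : Function.Surjective πS) (hπT : Function.Surjective πT)
    (hkS : RingHom.ker πS = maximalIdeal S) (hkT : RingHom.ker πT = maximalIdeal T)
    (hS : maximalIdeal S ≠ ⊥) (hT : maximalIdeal T ≠ ⊥)
    (M : Type) [AddCommGroup M] [Module ↥(fiberProd πS πT) M]
    [Module.Finite ↥(fiberProd πS πT) M] :
    ((∃ n : ℕ, ∀ i ≥ n, ExtZero ↥(fiberProd πS πT) M (M × ↥(fiberProd πS πT)) i) →
      PdLE ↥(fiberProd πS πT) M 1) ∧
    ((∀ i ≥ 1, ExtZero ↥(fiberProd πS πT) M (M × ↥(fiberProd πS πT)) i) →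
      Module.Free ↥(fiberProd πS πT) M) := by
  have := fiberProd_isNoetherianRing πS πT hπS hπT
  have := fiberProd_isLocalRing hkS hkT
  exact pdLE_one_and_free_of_ext_eq_zero (ker_sup_ker_eq_maximalIdeal hkS hkT) ker_inf_ker_eq_bot
    (ker_ρT_ne_bot hkS hS) (ker_ρS_ne_bot hkT hT) (ModuleCat.of _ M)
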